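/- arXiv:0806.3456 — 4 statements merged into one kernel-verified Lean document; each statement's English description precedes it below -/
import Mathlib

section
/- Let V be a finite set, E ⊆ V × V a finite set of arcs, and w : V × V → ℝ a weight function. Then the set of extreme points of the negative-weight flow polyhedron P(G,w) is exactly { (−1/w(C)) · χ(C) : C a directed cycle in E with w(C) < 0 }. -/
/-- `C` is a directed cycle in the arc set `E`: there are `n ≥ 1` pairwise distinct
vertices `v₀, …, v_{n-1}` with `C = {(v₀,v₁), (v₁,v₂), …, (v_{n-1},v₀)} ⊆ E`. -/
def IsDirectedCycle {V : Type*} [Fintype V] [DecidableEq V]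
    (E : Finset (V × V)) (C : Finset (V × V)) : Prop :=
  ∃ n : ℕ, ∃ f : Fin (n + 1) → V, Function.Injective f ∧
    C = Finset.image (fun i : Fin (n + 1) => (f i, f (i + 1))) Finset.univ ∧ C ⊆ E

/-- The negative-weight flow polyhedron `P(G,w)`: nonnegative circulations supported on
`E` with total weight `-1`. -/
def flowPolyhedron {V : Type*} [Fintype V] [DecidableEq V]
    (E : Finset (V × V)) (w : V × V → ℝ) : Set (V × V → ℝ) :=
  {y | (∀ e, e ∉ E → y e = 0) ∧ (∀ e, 0 ≤ y e) ∧
    (∀ u : V, ∑ v ∈ Finset.univ.filter (fun v => (u, v) ∈ E), y (u, v)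
            = ∑ v ∈ Finset.univ.filter (fun v => (v, u) ∈ E), y (v, u)) ∧
    (∑ e ∈ E, w e * y e) = -1}

section FlowCycles

variable {V : Type*} [Fintype V]

/-- A real-valued function on arcs that satisfies flow conservation at every vertex. -/
def IsCirculation (y : V × V → ℝ) : Prop :=
  ∀ u : V, ∑ v, y (u, v) = ∑ v, y (v, u)

theorem IsCirculation.add {y z : V × V → ℝ} (hy : IsCirculation y) (hz : IsCirculation z) :
    IsCirculation (y + z) := fun u => by
  simp only [Pi.add_apply, Finset.sum_add_distrib, hy u, hz u]

theorem IsCirculation.smul {y : V × V → ℝ} (hy : IsCirculation y) (c : ℝ) :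
    IsCirculation (c • y) := fun u => by
  simp only [Pi.smul_apply, smul_eq_mul, ← Finset.mul_sum, hy u]

variable [DecidableEq V]

theorem mem_flowPolyhedron_iff {E : Finset (V × V)} {w y : V × V → ℝ} :
    y ∈ flowPolyhedron E w ↔
      (∀ e, e ∉ E → y e = 0) ∧ (∀ e, 0 ≤ y e) ∧ IsCirculation y ∧ ∑ e, w e * y e = -1 := by
  have key : (∀ e, e ∉ E → y e = 0) →
      ((∀ u : V, ∑ v ∈ Finset.univ.filter (fun v => (u, v) ∈ E), y (u, v)
            = ∑ v ∈ Finset.univ.filter (fun v => (v, u) ∈ E), y (v, u)) ↔ IsCirculation y) ∧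
      ∑ e ∈ E, w e * y e = ∑ e, w e * y e := by
    intro h
    refine ⟨forall_congr' fun u => ?_, ?_⟩
    · rw [Finset.sum_filter_of_ne fun v _ hv => by_contra fun hE => hv (h _ hE),
        Finset.sum_filter_of_ne fun v _ hv => by_contra fun hE => hv (h _ hE)]
    · exact Finset.sum_subset (Finset.subset_univ E) fun e _ he => by rw [h e he, mul_zero]
  constructor
  · rintro ⟨h1, h2, h3, h4⟩
    exact ⟨h1, h2, (key h1).1.1 h3, (key h1).2 ▸ h4⟩
  · rintro ⟨h1, h2, h3, h4⟩
    exact ⟨h1, h2, (key h1).1.2 h3, (key h1).2.trans h4⟩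

/-- The characteristic vector of a set of arcs. -/
def arcIndicator (C : Finset (V × V)) : V × V → ℝ :=
  fun e => if e ∈ C then (1 : ℝ) else 0

theorem sum_mul_arcIndicator (w : V × V → ℝ) (C : Finset (V × V)) :
    ∑ e, w e * arcIndicator C e = ∑ e ∈ C, w e := by
  simp [arcIndicator]

theorem sum_out_of_cycle {n : ℕ} {f : Fin (n + 1) → V} (hf : Function.Injective f)
    {z : V × V → ℝ}
    (hz : ∀ e, e ∉ Finset.univ.image (fun i : Fin (n + 1) => (f i, f (i + 1))) → z e = 0)
    (i : Fin (n + 1)) : ∑ v, z (f i, v) = z (f i, f (i + 1)) := by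
  refine Fintype.sum_eq_single _ fun v hv => hz _ fun hmem => hv ?_
  obtain ⟨j, -, hj⟩ := Finset.mem_image.1 hmem
  obtain ⟨h1, h2⟩ := Prod.mk.inj hj
  rw [← h2, hf h1]

theorem sum_in_of_cycle {n : ℕ} {f : Fin (n + 1) → V} (hf : Function.Injective f)
    {z : V × V → ℝ}
    (hz : ∀ e, e ∉ Finset.univ.image (fun i : Fin (n + 1) => (f i, f (i + 1))) → z e = 0)
    (i : Fin (n + 1)) : ∑ v, z (v, f (i + 1)) = z (f i, f (i + 1)) := by
  refine Fintype.sum_eq_single _ fun v hv => hz _ fun hmem => hv ?_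
  obtain ⟨j, -, hj⟩ := Finset.mem_image.1 hmem
  obtain ⟨h1, h2⟩ := Prod.mk.inj hj
  rw [← h1, add_right_cancel (hf h2)]

theorem IsDirectedCycle.subset {E C : Finset (V × V)} (hC : IsDirectedCycle E C) : C ⊆ E := by
  obtain ⟨n, f, -, -, h⟩ := hC
  exact h

theorem IsDirectedCycle.nonempty {E C : Finset (V × V)} (hC : IsDirectedCycle E C) :
    C.Nonempty := by
  obtain ⟨n, f, -, rfl, -⟩ := hC
  exact Finset.univ_nonempty.image _

theorem IsDirectedCycle.mono {E E' C : Finset (V × V)} (hC : IsDirectedCycle E C) (h : E ⊆ E') :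
    IsDirectedCycle E' C := by
  obtain ⟨n, f, hf, hC, hE⟩ := hC
  exact ⟨n, f, hf, hC, hE.trans h⟩

theorem IsDirectedCycle.isCirculation_arcIndicator {E C : Finset (V × V)}
    (hC : IsDirectedCycle E C) : IsCirculation (arcIndicator C) := by
  obtain ⟨n, f, hf, rfl, -⟩ := hC
  intro u
  have hz : ∀ e, e ∉ Finset.univ.image (fun i : Fin (n + 1) => (f i, f (i + 1))) →
      arcIndicator (Finset.univ.image (fun i : Fin (n + 1) => (f i, f (i + 1)))) e = 0 :=
    fun e he => if_neg he
  by_cases hu : ∃ j, f j = u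
  · obtain ⟨j, rfl⟩ := hu
    obtain ⟨i, rfl⟩ : ∃ i, i + 1 = j := ⟨j - 1, sub_add_cancel j 1⟩
    rw [sum_out_of_cycle hf hz, sum_in_of_cycle hf hz]
    simp only [arcIndicator]
    rw [if_pos (Finset.mem_image_of_mem _ (Finset.mem_univ (i + 1))),
      if_pos (Finset.mem_image_of_mem _ (Finset.mem_univ i))]
  · rw [Finset.sum_eq_zero fun v _ => hz _ ?_, Finset.sum_eq_zero fun v _ => hz _ ?_]
    · intro h
      obtain ⟨j, -, hj⟩ := Finset.mem_image.1 h
      exact hu ⟨_, (Prod.mk.inj hj).2⟩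
    · intro h
      obtain ⟨j, -, hj⟩ := Finset.mem_image.1 h
      exact hu ⟨_, (Prod.mk.inj hj).1⟩

/-- A circulation that vanishes off a directed cycle is a multiple of its characteristic vector. -/
theorem IsDirectedCycle.exists_eq_smul_arcIndicator {E C : Finset (V × V)}
    (hC : IsDirectedCycle E C) {z : V × V → ℝ} (hz : IsCirculation z)
    (hzC : ∀ e, e ∉ C → z e = 0) : ∃ c : ℝ, z = c • arcIndicator C := by
  obtain ⟨n, f, hf, rfl, -⟩ := hC
  have hstep : ∀ i : Fin (n + 1), z (f (i + 1), f (i + 1 + 1)) = z (f i, f (i + 1)) := fun i => by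
    rw [← sum_out_of_cycle hf hzC, ← sum_in_of_cycle hf hzC, hz]
  have hconst : ∀ i : Fin (n + 1), z (f i, f (i + 1)) = z (f 0, f (0 + 1)) := by
    intro i
    induction i using Fin.induction with
    | zero => rfl
    | succ i ih => rw [← ih, ← hstep i.castSucc, Fin.coeSucc_eq_succ]
  refine ⟨z (f 0, f (0 + 1)), funext fun e => ?_⟩
  by_cases he : e ∈ Finset.univ.image (fun i : Fin (n + 1) => (f i, f (i + 1)))
  · obtain ⟨i, -, rfl⟩ := Finset.mem_image.1 he
    simp only [Pi.smul_apply, smul_eq_mul, arcIndicator, if_pos he, mul_one]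
    exact hconst i
  · rw [hzC e he, Pi.smul_apply, arcIndicator, if_neg he, smul_zero]

/-- Iterating a map on a finite type from a point reaches a directed cycle. -/
theorem exists_isDirectedCycle_of_forall_iterate {E : Finset (V × V)} (g : V → V) (u : V)
    (h : ∀ k : ℕ, (g^[k] u, g (g^[k] u)) ∈ E) : ∃ C, IsDirectedCycle E C := by
  obtain ⟨a, b, hab, heq⟩ : ∃ a b : ℕ, a < b ∧ g^[a] u = g^[b] u := by
    obtain ⟨a, b, hne, heq⟩ := Finite.exists_ne_map_eq_of_infinite fun k : ℕ => g^[k] u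
    rcases lt_or_gt_of_ne hne with hlt | hlt
    · exact ⟨a, b, hlt, heq⟩
    · exact ⟨b, a, hlt, heq.symm⟩
  set x := g^[a] u with hx
  have hper : Function.IsPeriodicPt g (b - a) x := by
    rw [Function.IsPeriodicPt, Function.IsFixedPt, hx, ← Function.iterate_add_apply,
      Nat.sub_add_cancel hab.le, ← heq]
  have hpos : 0 < Function.minimalPeriod g x := hper.minimalPeriod_pos (Nat.sub_pos_of_lt hab)
  obtain ⟨n, hn⟩ := Nat.exists_eq_add_one.2 hpos
  have hsucc : ∀ i : Fin (n + 1), g^[((i + 1 : Fin (n + 1)) : ℕ)] x = g (g^[(i : ℕ)] x) := by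
    intro i
    rw [Fin.val_add_one, ← Function.iterate_succ_apply' g]
    split_ifs with hi
    · rw [hi, Fin.val_last, Nat.succ_eq_add_one, ← hn, Function.iterate_minimalPeriod]
      rfl
    · rfl
  refine ⟨_, n, fun i => g^[(i : ℕ)] x, fun i j hij => ?_, rfl, ?_⟩
  · refine Fin.ext (Function.iterate_injOn_Iio_minimalPeriod ?_ ?_ hij)
    · exact i.isLt.trans_eq hn.symm
    · exact j.isLt.trans_eq hn.symm
  · intro e he
    obtain ⟨i, -, rfl⟩ := Finset.mem_image.1 he
    dsimp only
    rw [hsucc, hx, ← Function.iterate_add_apply]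
    exact h _

/-- The support of a nonzero nonnegative circulation contains a directed cycle. -/
theorem IsCirculation.exists_isDirectedCycle {y : V × V → ℝ} (hy : IsCirculation y)
    (h0 : ∀ e, 0 ≤ y e) (hne : y ≠ 0) :
    ∃ C, IsDirectedCycle (Finset.univ.filter fun e => 0 < y e) C := by
  have hpos : ∀ v : V, (∃ u, 0 < y (u, v)) → ∃ u, 0 < y (v, u) := by
    rintro v ⟨u, hu⟩
    have hin : 0 < ∑ t, y (t, v) :=
      Finset.sum_pos' (fun t _ => h0 _) ⟨u, Finset.mem_univ u, hu⟩
    rw [← hy v] at hin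
    obtain ⟨t, -, ht⟩ := Finset.exists_lt_of_sum_lt (f := fun _ => (0 : ℝ)) (by simpa using hin)
    exact ⟨t, ht⟩
  have hnext : ∀ v : V, ∃ u, (∃ t, 0 < y (v, t)) → 0 < y (v, u) := fun v => by
    by_cases hv : ∃ t, 0 < y (v, t)
    · exact ⟨hv.choose, fun _ => hv.choose_spec⟩
    · exact ⟨v, fun h => absurd h hv⟩
  choose g hg using hnext
  obtain ⟨⟨u, v⟩, huv⟩ := Function.ne_iff.1 hne
  refine exists_isDirectedCycle_of_forall_iterate g u fun k => ?_
  rw [Finset.mem_filter_univ]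
  induction k with
  | zero => exact hg u ⟨v, lt_of_le_of_ne (h0 _) (Ne.symm huv)⟩
  | succ k ih =>
    rw [Function.iterate_succ_apply']
    exact hg _ (hpos _ ⟨_, ih⟩)

theorem smul_add_mem_flowPolyhedron {E C : Finset (V × V)} {w y : V × V → ℝ}
    (hy : y ∈ flowPolyhedron E w) (hC : IsDirectedCycle E C) {t : ℝ}
    (ht : ∀ e ∈ C, 0 ≤ y e + t) (hw : 0 < 1 - t * ∑ e ∈ C, w e) :
    (1 - t * ∑ e ∈ C, w e)⁻¹ • (y + t • arcIndicator C) ∈ flowPolyhedron E w := by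
  rw [mem_flowPolyhedron_iff] at hy ⊢
  obtain ⟨h1, h2, h3, h4⟩ := hy
  refine ⟨fun e he => ?_, fun e => ?_, (h3.add (hC.isCirculation_arcIndicator.smul t)).smul _, ?_⟩
  · have : e ∉ C := fun h => he (hC.subset h)
    simp [arcIndicator, this, h1 e he]
  · refine mul_nonneg (inv_nonneg.2 hw.le) ?_
    by_cases he : e ∈ C
    · simpa [arcIndicator, he] using ht e he
    · simpa [arcIndicator, he] using h2 e
  · have hsum : ∑ e, w e * (y + t • arcIndicator C) e = -(1 - t * ∑ e ∈ C, w e) := by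
      simp only [Pi.add_apply, Pi.smul_apply, smul_eq_mul, mul_add, Finset.sum_add_distrib, h4,
        mul_left_comm _ t, ← Finset.mul_sum, sum_mul_arcIndicator]
      ring
    simp only [Pi.smul_apply, smul_eq_mul, mul_left_comm _ (_⁻¹), ← Finset.mul_sum] at hsum ⊢
    rw [hsum, mul_neg, inv_mul_cancel₀ hw.ne']

/-- An extreme point of the flow polyhedron determines every cycle in its support. -/
theorem arcIndicator_eq_of_mem_extremePoints {E C : Finset (V × V)} {w y : V × V → ℝ}
    (hy : y ∈ Set.extremePoints ℝ (flowPolyhedron E w)) (hC : IsDirectedCycle E C)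
    (hpos : ∀ e ∈ C, 0 < y e) : arcIndicator C = (-∑ e ∈ C, w e) • y := by
  set W := ∑ e ∈ C, w e
  obtain ⟨e₀, he₀, hmin⟩ := C.exists_min_image y hC.nonempty
  obtain ⟨t, ht0, hty, htW⟩ : ∃ t : ℝ, 0 < t ∧ t ≤ y e₀ ∧ t * |W| < 1 := by
    have hW1 : 0 < |W| + 1 := by positivity
    refine ⟨min (y e₀) (|W| + 1)⁻¹, lt_min (hpos _ he₀) (inv_pos.2 hW1), min_le_left _ _, ?_⟩
    calc min (y e₀) (|W| + 1)⁻¹ * |W| ≤ (|W| + 1)⁻¹ * |W| :=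
          mul_le_mul_of_nonneg_right (min_le_right _ _) (abs_nonneg W)
      _ < 1 := by rw [inv_mul_lt_iff₀ hW1]; linarith
  have hlt : |t * W| < 1 := by rwa [abs_mul, abs_of_pos ht0]
  obtain ⟨hl, hr⟩ := abs_lt.1 hlt
  have hp : 0 < 1 - t * W := by linarith
  have hm : 0 < 1 - -t * W := by linarith
  have hmem₁ := smul_add_mem_flowPolyhedron (t := t) hy.1 hC
    (fun e he => by linarith [hpos e he]) hp
  have hmem₂ := smul_add_mem_flowPolyhedron (t := -t) hy.1 hC
    (fun e he => by linarith [hmin e he]) hm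
  have hseg : y ∈ openSegment ℝ ((1 - t * W)⁻¹ • (y + t • arcIndicator C))
      ((1 - -t * W)⁻¹ • (y + -t • arcIndicator C)) := by
    refine ⟨(1 - t * W) / 2, (1 - -t * W) / 2, by linarith, by linarith, by ring, ?_⟩
    rw [div_eq_inv_mul, div_eq_inv_mul, mul_smul, mul_smul, smul_inv_smul₀ hp.ne',
      smul_inv_smul₀ hm.ne']
    module
  have heq := hy.2 hmem₁ hmem₂ hseg
  rw [inv_smul_eq_iff₀ hp.ne'] at heq
  ext e
  have he := congrFun heq e
  simp only [Pi.add_apply, Pi.smul_apply, smul_eq_mul] at he ⊢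
  refine mul_left_cancel₀ ht0.ne' ?_
  linarith

theorem smul_arcIndicator_mem_extremePoints {E C : Finset (V × V)} {w : V × V → ℝ}
    (hC : IsDirectedCycle E C) (hw : ∑ e ∈ C, w e < 0) :
    (-∑ e ∈ C, w e)⁻¹ • arcIndicator C ∈ Set.extremePoints ℝ (flowPolyhedron E w) := by
  have hcoef : ∀ c : ℝ, ∑ e, w e * (c • arcIndicator C) e = c * ∑ e ∈ C, w e := fun c => by
    simp only [Pi.smul_apply, smul_eq_mul, mul_left_comm _ c, ← Finset.mul_sum,
      sum_mul_arcIndicator]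
  have hinv : 0 < (-∑ e ∈ C, w e)⁻¹ := inv_pos.2 (neg_pos.2 hw)
  refine mem_extremePoints_iff_left.2 ⟨mem_flowPolyhedron_iff.2 ⟨fun e he => ?_, fun e => ?_,
    hC.isCirculation_arcIndicator.smul _, ?_⟩, ?_⟩
  · have : e ∉ C := fun h => he (hC.subset h)
    simp [arcIndicator, this]
  · refine mul_nonneg hinv.le ?_
    unfold arcIndicator
    split_ifs <;> norm_num
  · rw [hcoef, inv_neg, neg_mul, inv_mul_cancel₀ hw.ne]
  · rintro y₁ hy₁ y₂ hy₂ ⟨a, b, ha, hb, -, hab⟩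
    rw [mem_flowPolyhedron_iff] at hy₁ hy₂
    obtain ⟨-, hnonneg, hcirc, hsum⟩ := hy₁
    have hoff : ∀ e, e ∉ C → y₁ e = 0 := fun e he => by
      have h := congrFun hab e
      simp only [Pi.add_apply, Pi.smul_apply, smul_eq_mul, arcIndicator, if_neg he, mul_zero] at h
      have h2 := mul_nonneg hb.le (hy₂.2.1 e)
      have h1 := mul_nonneg ha.le (hnonneg e)
      have h0 : a * y₁ e = 0 := by linarith
      exact (mul_eq_zero.1 h0).resolve_left ha.ne'
    obtain ⟨c, rfl⟩ := hC.exists_eq_smul_arcIndicator hcirc hoff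
    rw [hcoef] at hsum
    congr 1
    refine eq_inv_of_mul_eq_one_left ?_
    linarith

end FlowCycles

/-- The extreme points of the negative-weight flow polyhedron
`P(G,w)` are exactly the points `(−1/w(C)) · χ(C)` for `C` a negative cycle of `G`. -/
theorem flowPolyhedron_extremePoints {V : Type*} [Fintype V] [DecidableEq V]
    (E : Finset (V × V)) (w : V × V → ℝ) :
    Set.extremePoints ℝ (flowPolyhedron E w) =
      {y | ∃ C : Finset (V × V), IsDirectedCycle E C ∧ (∑ e ∈ C, w e) < 0 ∧
        y = (-(∑ e ∈ C, w e))⁻¹ • (fun e => if e ∈ C then (1 : ℝ) else 0)} := by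
  ext y
  constructor
  · intro hy
    obtain ⟨hsupp, hnonneg, hcirc, hsum⟩ := mem_flowPolyhedron_iff.1 hy.1
    have hne : y ≠ 0 := by
      rintro rfl
      simp at hsum
    obtain ⟨C, hC⟩ := hcirc.exists_isDirectedCycle hnonneg hne
    have hpos : ∀ e ∈ C, 0 < y e := fun e he => (Finset.mem_filter.1 (hC.subset he)).2
    have hCE : IsDirectedCycle E C := hC.mono fun e he =>
      by_contra fun h => (Finset.mem_filter.1 he).2.ne' (hsupp e h)
    have heq := arcIndicator_eq_of_mem_extremePoints hy hCE hpos
    obtain ⟨e, he⟩ := hC.nonempty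
    have hone : 1 = (-∑ e ∈ C, w e) * y e := by
      simpa only [arcIndicator, if_pos he, Pi.smul_apply, smul_eq_mul] using congrFun heq e
    have hw : 0 < -∑ e ∈ C, w e := pos_of_mul_pos_left (hone ▸ one_pos) (hpos e he).le
    exact ⟨C, hCE, neg_pos.1 hw, (eq_inv_smul_iff₀ hw.ne').2 heq.symm⟩
  · rintro ⟨C, hC, hw, rfl⟩
    exact smul_arcIndicator_mem_extremePoints hC hw
end

section
/- Let V be a finite set, E ⊆ V × V a finite set of arcs, and w : V × V → ℝ a weight function. If C is a directed cycle in E with w(C) < 0, then the point y = (−1/w(C)) · χ(C) belongs to the negative-weight flow polyhedron P(G,w) and is an extreme point of P(G,w). -/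
section Cycle

variable {V : Type*} [DecidableEq V] {n : ℕ} {f : Fin (n + 1) → V}

/-- The arc set of the closed walk `f 0, f 1, …, f n, f 0`. -/
def cycleArcs (f : Fin (n + 1) → V) : Finset (V × V) :=
  Finset.image (fun i : Fin (n + 1) => (f i, f (i + 1))) Finset.univ

lemma mem_cycleArcs {e : V × V} : e ∈ cycleArcs f ↔ ∃ i, (f i, f (i + 1)) = e := by
  simp [cycleArcs]

variable [Fintype V]

lemma sum_out_cycleArcs {E : Finset (V × V)} (hf : Function.Injective f)
    (hE : cycleArcs f ⊆ E) {z : V × V → ℝ} (hz : ∀ e, e ∉ cycleArcs f → z e = 0)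
    (j : Fin (n + 1)) :
    ∑ v ∈ Finset.univ.filter (fun v => (f j, v) ∈ E), z (f j, v) = z (f j, f (j + 1)) := by
  apply Finset.sum_eq_single
  · intro v _ hv
    apply hz
    rw [mem_cycleArcs]
    rintro ⟨i, hi⟩
    obtain ⟨h1, h2⟩ := Prod.mk.inj hi
    obtain rfl := hf h1
    exact hv h2.symm
  · intro h
    refine absurd ?_ h
    rw [Finset.mem_filter]
    exact ⟨Finset.mem_univ _, hE (mem_cycleArcs.2 ⟨j, rfl⟩)⟩

lemma sum_in_cycleArcs {E : Finset (V × V)} (hf : Function.Injective f)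
    (hE : cycleArcs f ⊆ E) {z : V × V → ℝ} (hz : ∀ e, e ∉ cycleArcs f → z e = 0)
    (j : Fin (n + 1)) :
    ∑ v ∈ Finset.univ.filter (fun v => (v, f (j + 1)) ∈ E), z (v, f (j + 1))
      = z (f j, f (j + 1)) := by
  apply Finset.sum_eq_single
  · intro v _ hv
    apply hz
    rw [mem_cycleArcs]
    rintro ⟨i, hi⟩
    obtain ⟨h1, h2⟩ := Prod.mk.inj hi
    obtain rfl := add_right_cancel (hf h2)
    exact hv h1.symm
  · intro h
    refine absurd ?_ h
    rw [Finset.mem_filter]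
    exact ⟨Finset.mem_univ _, hE (mem_cycleArcs.2 ⟨j, rfl⟩)⟩

/-- A flow supported on a directed cycle takes the same value on all of its arcs. -/
lemma exists_const_of_conservation {E : Finset (V × V)} (hf : Function.Injective f)
    (hE : cycleArcs f ⊆ E) {z : V × V → ℝ} (hz : ∀ e, e ∉ cycleArcs f → z e = 0)
    (hcons : ∀ u : V, ∑ v ∈ Finset.univ.filter (fun v => (u, v) ∈ E), z (u, v)
      = ∑ v ∈ Finset.univ.filter (fun v => (v, u) ∈ E), z (v, u)) :
    ∃ c : ℝ, ∀ e ∈ cycleArcs f, z e = c := by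
  have step (j : Fin (n + 1)) : z (f (j + 1), f (j + 1 + 1)) = z (f j, f (j + 1)) := by
    rw [← sum_out_cycleArcs hf hE hz, hcons, sum_in_cycleArcs hf hE hz]
  refine ⟨z (f 0, f (0 + 1)), fun e he => ?_⟩
  obtain ⟨i, rfl⟩ := mem_cycleArcs.1 he
  induction i using Fin.induction with
  | zero => rfl
  | succ i ih =>
    have h := step i.castSucc
    rw [Fin.coeSucc_eq_succ] at h
    rw [h, ← Fin.coeSucc_eq_succ]
    have h' := ih (mem_cycleArcs.2 ⟨_, rfl⟩)
    rwa [Fin.coeSucc_eq_succ] at h' ⊢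

/-- Functions constant on a directed cycle and zero elsewhere satisfy flow conservation. -/
lemma conservation_of_const {E : Finset (V × V)} (hf : Function.Injective f)
    (hE : cycleArcs f ⊆ E) {z : V × V → ℝ} (hz : ∀ e, e ∉ cycleArcs f → z e = 0)
    {c : ℝ} (hc : ∀ e ∈ cycleArcs f, z e = c) (u : V) :
    ∑ v ∈ Finset.univ.filter (fun v => (u, v) ∈ E), z (u, v)
      = ∑ v ∈ Finset.univ.filter (fun v => (v, u) ∈ E), z (v, u) := by
  by_cases hu : ∃ j, f (j + 1) = u
  · obtain ⟨j, rfl⟩ := hu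
    rw [sum_out_cycleArcs hf hE hz, sum_in_cycleArcs hf hE hz,
      hc _ (mem_cycleArcs.2 ⟨_, rfl⟩), hc _ (mem_cycleArcs.2 ⟨_, rfl⟩)]
  · rw [Finset.sum_eq_zero, Finset.sum_eq_zero]
    · intro v _
      apply hz
      rw [mem_cycleArcs]
      rintro ⟨i, hi⟩
      exact hu ⟨i, (Prod.mk.inj hi).2⟩
    · intro v _
      apply hz
      rw [mem_cycleArcs]
      rintro ⟨i, hi⟩
      exact hu ⟨i - 1, by rw [sub_add_cancel]; exact (Prod.mk.inj hi).1⟩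

end Cycle

lemma sum_mul_eq_of_const {α : Type*} {E C : Finset α} (hCE : C ⊆ E) (w : α → ℝ)
    {z : α → ℝ} (hz : ∀ e, e ∉ C → z e = 0) {c : ℝ} (hc : ∀ e ∈ C, z e = c) :
    ∑ e ∈ E, w e * z e = (∑ e ∈ C, w e) * c := by
  rw [← Finset.sum_subset hCE (fun e _ he => by rw [hz e he, mul_zero]), Finset.sum_mul]
  exact Finset.sum_congr rfl fun e he => by rw [hc e he]

/-- If `C` is a directed cycle in `E` with `w(C) < 0`, then
`y = (−1/w(C)) · χ(C)` belongs to `P(G,w)` and is an extreme point of `P(G,w)`. -/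
theorem negCycle_mem_and_extremePoint {V : Type*} [Fintype V] [DecidableEq V]
    (E : Finset (V × V)) (w : V × V → ℝ)
    (C : Finset (V × V)) (hC : IsDirectedCycle E C) (hw : (∑ e ∈ C, w e) < 0)
    (y : V × V → ℝ)
    (hy : y = (-(∑ e ∈ C, w e))⁻¹ • (fun e => if e ∈ C then (1 : ℝ) else 0)) :
    y ∈ flowPolyhedron E w ∧ y ∈ Set.extremePoints ℝ (flowPolyhedron E w) := by
  obtain ⟨n, f, hf, hCf, hCE⟩ := hC
  change C = cycleArcs f at hCf
  subst hCf
  set W := ∑ e ∈ cycleArcs f, w e with hW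
  have hy_on : ∀ e ∈ cycleArcs f, y e = (-W)⁻¹ := fun e he => by simp [hy, he]
  have hy_off : ∀ e, e ∉ cycleArcs f → y e = 0 := fun e he => by simp [hy, he]
  have hpos : 0 < (-W)⁻¹ := inv_pos.2 (neg_pos.2 hw)
  have hWinv : W * (-W)⁻¹ = -1 := by
    rw [inv_neg, mul_neg, mul_inv_cancel₀ hw.ne]
  have hmem : y ∈ flowPolyhedron E w := by
    refine ⟨fun e he => hy_off e fun h => he (hCE h), fun e => ?_,
      conservation_of_const hf hCE hy_off hy_on, ?_⟩
    · by_cases he : e ∈ cycleArcs f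
      · exact (hy_on e he).symm ▸ hpos.le
      · exact (hy_off e he).ge
    · rw [sum_mul_eq_of_const hCE w hy_off hy_on, hWinv]
  refine ⟨hmem, hmem, ?_⟩
  rintro x₁ ⟨-, hx₁, hcons, hsum⟩ x₂ ⟨-, hx₂, -, -⟩ ⟨a, b, ha, hb, -, hab⟩
  have hx_off : ∀ e, e ∉ cycleArcs f → x₁ e = 0 := fun e he => by
    have h : a * x₁ e + b * x₂ e = 0 := by
      rw [← hy_off e he, ← hab]
      rfl
    have h₁ := mul_nonneg ha.le (hx₁ e)
    have h₂ := mul_nonneg hb.le (hx₂ e)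
    exact (mul_eq_zero.1 (by linarith : a * x₁ e = 0)).resolve_left ha.ne'
  obtain ⟨c, hc⟩ := exists_const_of_conservation hf hCE hx_off hcons
  rw [sum_mul_eq_of_const hCE w hx_off hc, ← hWinv] at hsum
  have hcW : c = (-W)⁻¹ := mul_left_cancel₀ hw.ne hsum
  funext e
  by_cases he : e ∈ cycleArcs f
  · rw [hc e he, hy_on e he, hcW]
  · rw [hx_off e he, hy_off e he]
end

section
/- Let V be a finite set, E ⊆ V × V a finite set of arcs, and w : V × V → ℝ a weight function. If y is an extreme point of the negative-weight flow polyhedron P(G,w), then there is no directed cycle C in E with w(C) = 0 and y_e > 0 for every arc e ∈ C. -/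
/-- An extreme point of the flow polyhedron admits no nonzero perturbation by a circulation of
weight zero that it dominates in absolute value. -/
theorem eq_zero_of_mem_extremePoints_flowPolyhedron {V : Type*} [Fintype V] [DecidableEq V]
    {E : Finset (V × V)} {w y d : V × V → ℝ}
    (hy : y ∈ Set.extremePoints ℝ (flowPolyhedron E w)) (hle : ∀ e, |d e| ≤ y e)
    (hcons : ∀ u : V, ∑ v ∈ Finset.univ.filter (fun v => (u, v) ∈ E), d (u, v)
      = ∑ v ∈ Finset.univ.filter (fun v => (v, u) ∈ E), d (v, u))
    (hw : ∑ e ∈ E, w e * d e = 0) : d = 0 := by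
  obtain ⟨⟨hsupp, -, hflow, hweight⟩, hext⟩ := mem_extremePoints.1 hy
  have hd (e) (he : e ∉ E) : d e = 0 := abs_nonpos_iff.1 ((hle e).trans (hsupp e he).le)
  have hadd : y + d ∈ flowPolyhedron E w := by
    refine ⟨fun e he => by simp [hsupp e he, hd e he], fun e => ?_, fun u => ?_, ?_⟩
    · have := (abs_le.1 (hle e)).1
      simp only [Pi.add_apply]
      linarith
    · simp only [Pi.add_apply, Finset.sum_add_distrib, hflow u, hcons u]
    · simp only [Pi.add_apply, mul_add, Finset.sum_add_distrib, hweight, hw, add_zero]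
  have hsub : y - d ∈ flowPolyhedron E w := by
    refine ⟨fun e he => by simp [hsupp e he, hd e he], fun e => ?_, fun u => ?_, ?_⟩
    · have := (abs_le.1 (hle e)).2
      simp only [Pi.sub_apply]
      linarith
    · simp only [Pi.sub_apply, Finset.sum_sub_distrib, hflow u, hcons u]
    · simp only [Pi.sub_apply, mul_sub, Finset.sum_sub_distrib, hweight, hw, sub_zero]
  have hseg : y ∈ openSegment ℝ (y + d) (y - d) := by
    refine ⟨1 / 2, 1 / 2, by norm_num, by norm_num, by norm_num, ?_⟩
    ext e
    simp only [Pi.add_apply, Pi.smul_apply, Pi.sub_apply, smul_eq_mul]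
    ring
  simpa using (hext _ hadd _ hsub hseg).1

/-- A directed cycle has as many arcs leaving any vertex as arcs entering it. -/
theorem IsDirectedCycle.sum_indicator_eq {V : Type*} [Fintype V] [DecidableEq V]
    {E C : Finset (V × V)} (hC : IsDirectedCycle E C) (ε : ℝ) (u : V) :
    ∑ v ∈ Finset.univ.filter (fun v => (u, v) ∈ E), (if (u, v) ∈ C then ε else 0)
      = ∑ v ∈ Finset.univ.filter (fun v => (v, u) ∈ E), (if (v, u) ∈ C then ε else 0) := by
  obtain ⟨n, f, hf, rfl, hCE⟩ := hC
  set C := Finset.image (fun i : Fin (n + 1) => (f i, f (i + 1))) Finset.univ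
  have hinj : Function.Injective (fun i : Fin (n + 1) => (f i, f (i + 1))) :=
    fun i j h => hf (Prod.ext_iff.1 h).1
  have harc (i : Fin (n + 1)) : (f i, f (i + 1)) ∈ E :=
    hCE (Finset.mem_image_of_mem _ (Finset.mem_univ i))
  have hind (e : V × V) : (if e ∈ C then ε else 0)
      = ∑ i : Fin (n + 1), if (f i, f (i + 1)) = e then ε else 0 := by
    rw [← Finset.sum_image (s := Finset.univ) (f := fun a => if a = e then ε else 0) hinj.injOn,
      Finset.sum_ite_eq']
  have hout (i : Fin (n + 1)) : ∑ v ∈ Finset.univ.filter (fun v => (u, v) ∈ E),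
      (if (f i, f (i + 1)) = (u, v) then ε else 0) = if f i = u then ε else 0 := by
    split_ifs with h
    · subst h
      simp [harc i]
    · simp [h]
  have hin (i : Fin (n + 1)) : ∑ v ∈ Finset.univ.filter (fun v => (v, u) ∈ E),
      (if (f i, f (i + 1)) = (v, u) then ε else 0) = if f (i + 1) = u then ε else 0 := by
    split_ifs with h
    · subst h
      simp [harc i]
    · simp [h]
  simp only [hind]
  rw [Finset.sum_comm, Finset.sum_comm (s := Finset.univ.filter (fun v => (v, u) ∈ E))]
  simp only [hout, hin]
  exact (Equiv.sum_comp (Equiv.addRight (1 : Fin (n + 1))) (fun i => if f i = u then ε else 0)).symm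

/-- If `y` is an extreme point of `P(G,w)`, then there is no directed
cycle `C` in `E` with `w(C) = 0` and `y_e > 0` for every arc `e ∈ C`. -/
theorem extremePoint_no_zero_cycle {V : Type*} [Fintype V] [DecidableEq V]
    (E : Finset (V × V)) (w : V × V → ℝ)
    (y : V × V → ℝ) (hy : y ∈ Set.extremePoints ℝ (flowPolyhedron E w)) :
    ¬ ∃ C : Finset (V × V), IsDirectedCycle E C ∧ (∑ e ∈ C, w e) = 0 ∧
        ∀ e ∈ C, 0 < y e := by
  rintro ⟨C, hC, hw, hpos⟩
  have hCE : C ⊆ E := hC.choose_spec.choose_spec.2.2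
  have hne : C.Nonempty := by
    obtain ⟨n, f, -, rfl, -⟩ := hC
    exact Finset.univ_nonempty.image _
  obtain ⟨a, ha, hmin⟩ := C.exists_min_image y hne
  have hzero : (fun e => if e ∈ C then y a else 0) = (0 : V × V → ℝ) := by
    refine eq_zero_of_mem_extremePoints_flowPolyhedron hy (fun e => ?_)
      (hC.sum_indicator_eq (y a)) ?_
    · split_ifs with he
      · rw [abs_of_pos (hpos a ha)]
        exact hmin e he
      · simpa using hy.1.2.1 e
    · simp only [mul_ite, mul_zero, Finset.sum_ite_mem, Finset.inter_eq_right.2 hCE,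
        ← Finset.sum_mul, hw, zero_mul]
  have := congrFun hzero a
  simp only [ha, if_true, Pi.zero_apply] at this
  exact (hpos a ha).ne' this
end

section
/- Let V be a finite set and E ⊆ V × V a finite set of arcs. Let y : V × V → ℝ be supported on E, satisfy y_e ≥ 0 for all arcs e, and satisfy flow conservation. Then every arc e with y_e > 0 lies on a directed cycle C in E such that y_f > 0 for every arc f ∈ C. (Equivalently, the support graph of a nonnegative circulation is a disjoint union of strongly connected components.) -/
/-- A reflexive-transitive chain of a relation can be realized by a sequence of
pairwise distinct points. -/
theorem Relation.ReflTransGen.exists_injOn_seq {V : Type*} {r : V → V → Prop} {b a : V}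
    (h : Relation.ReflTransGen r b a) :
    ∃ (n : ℕ) (p : ℕ → V), p 0 = b ∧ p n = a ∧ (∀ i < n, r (p i) (p (i + 1))) ∧
      ∀ i j, i < j → j ≤ n → p i ≠ p j := by
  classical
  have hex : ∃ (n : ℕ) (p : ℕ → V), p 0 = b ∧ p n = a ∧ ∀ i < n, r (p i) (p (i + 1)) := by
    induction h with
    | refl => exact ⟨0, fun _ => b, rfl, rfl, by simp⟩
    | @tail c d _ hcd ih =>
      obtain ⟨n, p, h0, hn, hp⟩ := ih
      refine ⟨n + 1, fun k => if k ≤ n then p k else d, by simpa using h0, by simp, ?_⟩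
      intro i hi
      rcases Nat.lt_succ_iff_lt_or_eq.mp hi with hi | rfl
      · simpa [hi.le, Nat.succ_le_of_lt hi] using hp i hi
      · simpa [hn] using hcd
  obtain ⟨p, h0, hn, hp⟩ := Nat.find_spec hex
  refine ⟨Nat.find hex, p, h0, hn, hp, fun i j hij hj heq => ?_⟩
  refine Nat.find_min hex (m := Nat.find hex - (j - i)) (by omega)
    ⟨fun k => if k ≤ i then p k else p (k + (j - i)), by simpa using h0, ?_, ?_⟩
  · dsimp only
    split_ifs with hk
    · rw [show Nat.find hex - (j - i) = i by omega, heq,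
        show j = Nat.find hex by omega, hn]
    · rw [show Nat.find hex - (j - i) + (j - i) = Nat.find hex by omega, hn]
  · intro k hk
    dsimp only
    rcases lt_trichotomy k i with h | rfl | h
    · rw [if_pos h.le, if_pos (Nat.succ_le_of_lt h)]
      exact hp k (by omega)
    · rw [if_pos le_rfl, if_neg (by omega), heq, show k + 1 + (j - k) = j + 1 by omega]
      exact hp j (by omega)
    · rw [if_neg (by omega), if_neg (by omega), show k + 1 + (j - i) = k + (j - i) + 1 by omega]
      exact hp _ (by omega)

/-- In a nonnegative circulation, the tail of an arc with positive flow is reachable from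
its head along arcs with positive flow. -/
theorem reflTransGen_of_pos_circulation {V : Type*} [Fintype V] {y : V × V → ℝ}
    (hnonneg : ∀ e, 0 ≤ y e) (hflow : ∀ u, ∑ v, y (u, v) = ∑ v, y (v, u)) {a b : V}
    (hab : 0 < y (a, b)) : Relation.ReflTransGen (fun u v => 0 < y (u, v)) b a := by
  classical
  by_contra ha
  set R : Finset V := {u | Relation.ReflTransGen (fun u v => 0 < y (u, v)) b u} with hR
  have haR : a ∈ Rᶜ := by simpa [hR] using ha
  have hbR : b ∈ R := by simpa [hR] using Relation.ReflTransGen.refl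
  have hout : ∀ u ∈ R, ∀ v ∈ Rᶜ, y (u, v) = 0 := by
    intro u hu v hv
    by_contra hne
    simp only [hR, Finset.mem_compl, Finset.mem_filter_univ] at hu hv
    exact hv (hu.tail ((hnonneg _).lt_of_ne' hne))
  have hsum : ∑ u ∈ R, ∑ v, y (u, v) = ∑ u ∈ R, ∑ v, y (v, u) :=
    Finset.sum_congr rfl fun u _ => hflow u
  simp only [← Finset.sum_add_sum_compl R, Finset.sum_add_distrib] at hsum
  rw [Finset.sum_comm (s := R) (t := R), add_right_inj,
    Finset.sum_eq_zero fun u hu => Finset.sum_eq_zero (hout u hu)] at hsum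
  refine absurd hsum (ne_of_lt ?_)
  exact Finset.sum_pos' (fun u _ => Finset.sum_nonneg fun v _ => hnonneg _)
    ⟨b, hbR, Finset.sum_pos' (fun v _ => hnonneg _) ⟨a, haR, hab⟩⟩

/-- If `y` is a nonnegative circulation supported on `E`, then every
arc `e` with `y_e > 0` lies on a directed cycle `C` in `E` all of whose arcs carry
positive flow. -/
theorem support_arc_mem_positive_cycle {V : Type*} [Fintype V] [DecidableEq V]
    (E : Finset (V × V)) (y : V × V → ℝ)
    (hsupp : ∀ e, e ∉ E → y e = 0) (hnonneg : ∀ e, 0 ≤ y e)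
    (hflow : ∀ u : V, ∑ v ∈ Finset.univ.filter (fun v => (u, v) ∈ E), y (u, v)
                    = ∑ v ∈ Finset.univ.filter (fun v => (v, u) ∈ E), y (v, u)) :
    ∀ e : V × V, 0 < y e →
      ∃ C : Finset (V × V), IsDirectedCycle E C ∧ e ∈ C ∧ ∀ f ∈ C, 0 < y f := by
  rintro ⟨a, b⟩ hab
  have hmem : ∀ e, 0 < y e → e ∈ E := fun e he => by
    by_contra h
    exact he.ne' (hsupp e h)
  have hflow' : ∀ u, ∑ v, y (u, v) = ∑ v, y (v, u) := by
    intro u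
    have h := hflow u
    rwa [Finset.sum_filter_of_ne fun v _ hv => hmem _ ((hnonneg _).lt_of_ne' hv),
      Finset.sum_filter_of_ne fun v _ hv => hmem _ ((hnonneg _).lt_of_ne' hv)] at h
  obtain ⟨n, p, h0, hn, hp, hinj⟩ :=
    (reflTransGen_of_pos_circulation hnonneg hflow' hab).exists_injOn_seq
  have hpos : ∀ i : Fin (n + 1), 0 < y (p i, p (i + 1 : Fin (n + 1))) := by
    intro i
    induction i using Fin.lastCases with
    | last => simpa [h0, hn] using hab
    | cast i => simpa using hp i i.isLt
  have hC : ∀ f ∈ Finset.image (fun i : Fin (n + 1) => (p i, p (i + 1 : Fin (n + 1))))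
      Finset.univ, 0 < y f := by
    simpa [-Prod.forall] using hpos
  refine ⟨_, ⟨n, fun i => p i, ?_, rfl, fun f hf => hmem f (hC f hf)⟩, ?_, hC⟩
  · intro i j hij
    by_contra hne
    rcases lt_or_gt_of_ne hne with h | h
    · exact hinj i j h (by omega) hij
    · exact hinj j i h (by omega) hij.symm
  · exact Finset.mem_image.mpr ⟨Fin.last n, Finset.mem_univ _, by simp [h0, hn]⟩
end
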